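/- (Interpolation with logarithmic loss between atomic spaces, Proposition B.10.) Let m ∈ {1, 2, 3}, let q₁, …, q_m ∈ (2, ∞), let B and E be Banach spaces, and let T be an m-linear map defined on U^{q₁}(ℝ, B) × ⋯ × U^{q_m}(ℝ, B) with values in E satisfying ‖T(u₁, …, u_m)‖_E ≤ C ∏_{i=1}^m ‖u_i‖_{U^{q_i}} for all u_i ∈ U^{q_i}(ℝ, B), and also ‖T(u₁, …, u_m)‖_E ≤ C₂ ∏_{i=1}^m ‖u_i‖_{U²} whenever each u_i ∈ U²(ℝ, B), for constants 0 < C₂ ≤ C. Then there is a constant κ depending only on m and q₁, …, q_m such that for all right-continuous functions u_i : ℝ → B with lim_{t → −∞} u_i(t) = 0 and finite V²-norm (which therefore belong to each U^{q_i}(ℝ, B)), ‖T(u₁, …, u_m)‖_E ≤ κ C₂ (log(C/C₂) + 1)^m ∏_{i=1}^m ‖u_i‖_{V²}. -/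

import Mathlib

open MeasureTheory Filter
open scoped ENNReal Classical

section UpVp
variable {B : Type*} [NormedAddCommGroup B] [NormedSpace ℂ B]

/-- Extension of a function on `ℝ` to `EReal`, with value `0` at `∞`
(the convention `v(∞) = 0`). -/
noncomputable def extEReal (v : ℝ → B) : EReal → B :=
  fun x => if x = ⊤ then 0 else if x = ⊥ then 0 else v x.toReal

/-- A `U^p` atom: a step function `a(s) = ∑_{k=1}^{K} 1_{[t_{k-1}, t_k)}(s) φ_{k-1}`
associated with a partition `-∞ < t₀ < t₁ < ⋯ < t_K ≤ ∞` and values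
`φ₀, …, φ_{K-1} ∈ B` with `∑_{k} ‖φ_k‖^p = 1`. -/
noncomputable def IsUpAtom (p : ℝ) (a : ℝ → B) : Prop :=
  ∃ (K : ℕ) (t : Fin (K + 1) → EReal) (φ : Fin K → B),
    StrictMono t ∧ (∀ i, t i ≠ ⊥) ∧ (∑ k, ‖φ k‖ ^ p) = 1 ∧
    ∀ s : ℝ, a s =
      ∑ k : Fin K, if t k.castSucc ≤ (s : EReal) ∧ (s : EReal) < t k.succ then φ k else 0

/-- The `U^p` (atomic space) norm of `u : ℝ → B`: the infimum of `∑_j |λ_j|` over all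
representations `u = ∑_j λ_j a_j` (pointwise) with `(λ_j) ∈ ℓ¹(ℂ)` and `U^p` atoms `a_j`;
it equals `∞` when no such representation exists. -/
noncomputable def UpNorm (p : ℝ) (u : ℝ → B) : ℝ≥0∞ :=
  sInf { M : ℝ≥0∞ | ∃ (lam : ℕ → ℂ) (a : ℕ → ℝ → B),
    (∀ j, IsUpAtom p (a j)) ∧ Summable (fun j => ‖lam j‖) ∧
    (∀ s : ℝ, HasSum (fun j => lam j • a j s) (u s)) ∧
    M = ENNReal.ofReal (∑' j, ‖lam j‖) }

/-- The `V^p` variation norm of `v : ℝ → B`: the supremum over partitions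
`-∞ < t₀ < t₁ < ⋯ < t_K ≤ ∞` of `(∑_{i=1}^K ‖v(t_i) - v(t_{i-1})‖^p)^{1/p}`,
with the convention `v(∞) = 0`. -/
noncomputable def VpNorm (p : ℝ) (v : ℝ → B) : ℝ≥0∞ :=
  ⨆ (K : ℕ) (t : Fin (K + 1) → EReal) (_ : StrictMono t) (_ : ∀ i, t i ≠ ⊥),
    ENNReal.ofReal
      ((∑ i : Fin K, ‖extEReal v (t i.succ) - extEReal v (t i.castSucc)‖ ^ p) ^ (1 / p))

end UpVp

section StepFunctions

variable {B : Type*} [NormedAddCommGroup B]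

/-- `f` is a right-continuous step function, vanishing near `-∞`, whose jumps lie in `S`. -/
def IsStepOn (S : Finset ℝ) (f : ℝ → B) : Prop :=
  (∀ x, (∀ s ∈ S, x < s) → f x = 0) ∧
    ∀ x y, x ≤ y → (∀ s ∈ S, s ≤ y → s ≤ x) → f x = f y

theorem IsStepOn.sub {S S' : Finset ℝ} {f g : ℝ → B} (hf : IsStepOn S f)
    (hg : IsStepOn S' g) : IsStepOn (S ∪ S') (f - g) := by
  refine ⟨fun x hx => ?_, fun x y hxy h => ?_⟩
  · simp [hf.1 x fun s hs => hx s (Finset.mem_union_left _ hs),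
      hg.1 x fun s hs => hx s (Finset.mem_union_right _ hs)]
  · simp [hf.2 x y hxy fun s hs => h s (Finset.mem_union_left _ hs),
      hg.2 x y hxy fun s hs => h s (Finset.mem_union_right _ hs)]

/-- The partition points attached to a finite set of reals, with `∞` appended. -/
noncomputable def stepPartition (S : Finset ℝ) : Fin (S.card + 1) → EReal :=
  Fin.snoc (α := fun _ => EReal) (fun k => ((S.orderEmbOfFin rfl k : ℝ) : EReal)) ⊤

theorem stepPartition_castSucc (S : Finset ℝ) (k : Fin S.card) :
    stepPartition S k.castSucc = ((S.orderEmbOfFin rfl k : ℝ) : EReal) := by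
  simp [stepPartition]

theorem stepPartition_last (S : Finset ℝ) : stepPartition S (Fin.last _) = ⊤ := by
  simp [stepPartition]

theorem stepPartition_strictMono (S : Finset ℝ) : StrictMono (stepPartition S) := by
  intro i j
  induction i using Fin.lastCases with
  | last => intro h; exact absurd h (Fin.le_last j).not_gt
  | cast i =>
    induction j using Fin.lastCases with
    | last => intro; rw [stepPartition_castSucc, stepPartition_last]; exact EReal.coe_lt_top _
    | cast j =>
      intro h
      rw [stepPartition_castSucc, stepPartition_castSucc, EReal.coe_lt_coe_iff]
      exact (S.orderEmbOfFin rfl).strictMono (by simpa using h)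

theorem stepPartition_ne_bot (S : Finset ℝ) (i : Fin (S.card + 1)) :
    stepPartition S i ≠ ⊥ := by
  induction i using Fin.lastCases with
  | last => simp [stepPartition_last]
  | cast i => simp [stepPartition_castSucc]

theorem IsStepOn.eq_sum {S : Finset ℝ} {f : ℝ → B} (hf : IsStepOn S f) (x : ℝ) :
    f x = ∑ k : Fin S.card, if stepPartition S k.castSucc ≤ (x : EReal) ∧
      (x : EReal) < stepPartition S k.succ then f (S.orderEmbOfFin rfl k) else 0 := by
  by_cases hx : ∀ s ∈ S, x < s
  · rw [hf.1 x hx, Finset.sum_eq_zero]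
    intro k _
    rw [if_neg]
    rw [stepPartition_castSucc, EReal.coe_le_coe_iff]
    exact fun h => (hx _ (S.orderEmbOfFin_mem rfl k)).not_ge h.1
  · push Not at hx
    obtain ⟨s₀, hs₀, hs₀x⟩ := hx
    obtain ⟨s, hs, hmax⟩ := (S.filter (· ≤ x)).exists_max_image id ⟨s₀, by simp [hs₀, hs₀x]⟩
    rw [Finset.mem_filter] at hs
    obtain ⟨k₀, rfl⟩ : ∃ k₀, S.orderEmbOfFin rfl k₀ = s := by
      have := S.range_orderEmbOfFin rfl
      have h : s ∈ Set.range (S.orderEmbOfFin rfl) := by rw [this]; exact hs.1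
      exact h
    have key : ∀ k, S.orderEmbOfFin rfl k ≤ x → k ≤ k₀ := fun k hk => by
      simpa using hmax _ (Finset.mem_filter.2 ⟨S.orderEmbOfFin_mem rfl k, hk⟩)
    rw [Finset.sum_eq_single k₀]
    · rw [if_pos]
      · refine (hf.2 _ _ hs.2 fun s' hs' hs'x => ?_).symm
        exact hmax s' (Finset.mem_filter.2 ⟨hs', hs'x⟩)
      · refine ⟨by rw [stepPartition_castSucc]; exact EReal.coe_le_coe_iff.2 hs.2, ?_⟩
        by_contra! h
        rcases Fin.eq_castSucc_or_eq_last k₀.succ with ⟨k', hk'⟩ | hk'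
        · rw [hk', stepPartition_castSucc, EReal.coe_le_coe_iff] at h
          have h1 := key _ h
          have h2 := congrArg Fin.val hk'
          simp only [Fin.val_succ, Fin.val_castSucc] at h2
          rw [Fin.le_def] at h1
          omega
        · rw [hk', stepPartition_last] at h
          exact absurd h (EReal.coe_lt_top x).not_ge
    · intro k _ hk
      rw [if_neg]
      rintro ⟨h1, h2⟩
      rw [stepPartition_castSucc, EReal.coe_le_coe_iff] at h1
      have h3 : k < k₀ := lt_of_le_of_ne (key k h1) hk
      have h4 : stepPartition S k.succ ≤ stepPartition S k₀.castSucc := by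
        apply (stepPartition_strictMono S).monotone
        rw [Fin.le_def]
        simpa using h3
      rw [stepPartition_castSucc] at h4
      exact (h2.trans_le h4).not_ge (EReal.coe_le_coe_iff.2 hs.2)
    · simp

variable [NormedSpace ℂ B]

/-- `f` is a scalar multiple of a `U^p` atom, with factor at most `c` in absolute value. -/
def IsAtomMultiple (p c : ℝ) (f : ℝ → B) : Prop :=
  ∃ (l : ℂ) (a : ℝ → B), IsUpAtom p a ∧ ‖l‖ ≤ c ∧ f = l • a

theorem exists_isUpAtom [Nontrivial B] (p : ℝ) : ∃ a : ℝ → B, IsUpAtom p a := by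
  obtain ⟨b, hb⟩ := exists_norm_eq B (zero_le_one (α := ℝ))
  refine ⟨_, 1, ![0, ⊤], fun _ => b, ?_, ?_, by simp [hb], fun s => rfl⟩
  · intro i j h
    fin_cases i <;> fin_cases j <;> simp_all
  · intro i
    fin_cases i <;> simp

theorem isAtomMultiple_zero [Nontrivial B] {p c : ℝ} (hc : 0 ≤ c) :
    IsAtomMultiple p c (0 : ℝ → B) := by
  obtain ⟨a, ha⟩ := exists_isUpAtom (B := B) p
  exact ⟨0, a, ha, by simpa using hc, by simp⟩

theorem IsStepOn.isAtomMultiple [Nontrivial B] {S : Finset ℝ} {f : ℝ → B}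
    (hf : IsStepOn S f) {p D K : ℝ} (hp : 0 < p) (hD : ∀ x, ‖f x‖ ≤ D) (hD0 : 0 ≤ D)
    (hK : (S.card : ℝ) ≤ K) : IsAtomMultiple p (D * K ^ (1 / p)) f := by
  have hK0 : 0 ≤ K := (Nat.cast_nonneg _).trans hK
  set e := S.orderEmbOfFin rfl
  set A : ℝ := ∑ k, ‖f (e k)‖ ^ p with hA
  have hA0 : 0 ≤ A := Finset.sum_nonneg fun k _ => by positivity
  have hAle : A ^ (1 / p) ≤ D * K ^ (1 / p) := by
    have h1 : A ≤ K * D ^ p := by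
      calc A ≤ ∑ _k : Fin S.card, D ^ p :=
            Finset.sum_le_sum fun k _ => Real.rpow_le_rpow (norm_nonneg _) (hD _) hp.le
        _ = S.card * D ^ p := by simp
        _ ≤ K * D ^ p := by gcongr
    calc A ^ (1 / p) ≤ (K * D ^ p) ^ (1 / p) := Real.rpow_le_rpow hA0 h1 (by positivity)
      _ = D * K ^ (1 / p) := by
        rw [Real.mul_rpow hK0 (by positivity), ← Real.rpow_mul hD0, mul_one_div_cancel hp.ne',
          Real.rpow_one, mul_comm]
  rcases hA0.eq_or_lt with h0 | hpos
  · have hz : f = 0 := by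
      have h1 := (Finset.sum_eq_zero_iff_of_nonneg (fun k _ => by positivity)).1 h0.symm
      funext x
      rw [hf.eq_sum x]
      refine Finset.sum_eq_zero fun k hk => ?_
      have := (Real.rpow_eq_zero (norm_nonneg _) hp.ne').1 (h1 k hk)
      rw [norm_eq_zero] at this
      split_ifs
      · exact this
      · rfl
    rw [hz]
    exact isAtomMultiple_zero (by positivity)
  · set c : ℝ := A ^ (1 / p) with hc
    have hcpos : 0 < c := by positivity
    have hcp : c ^ p = A := by
      rw [hc, ← Real.rpow_mul hA0, one_div_mul_cancel hp.ne', Real.rpow_one]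
    have hc0 : (c : ℂ) ≠ 0 := by exact_mod_cast hcpos.ne'
    refine ⟨c, (c : ℂ)⁻¹ • f, ⟨S.card, stepPartition S, fun k => (c : ℂ)⁻¹ • f (e k),
      stepPartition_strictMono S, stepPartition_ne_bot S, ?_, fun x => ?_⟩, ?_, ?_⟩
    · have h : ∀ k, ‖(c : ℂ)⁻¹ • f (e k)‖ ^ p = A⁻¹ * ‖f (e k)‖ ^ p := fun k => by
        rw [norm_smul, norm_inv, Complex.norm_real, Real.norm_of_nonneg hcpos.le,
          Real.mul_rpow (by positivity) (by positivity), Real.inv_rpow hcpos.le, hcp]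
      rw [Finset.sum_congr rfl fun k _ => h k, ← Finset.mul_sum, ← hA, inv_mul_cancel₀ hpos.ne']
    · rw [Pi.smul_apply, hf.eq_sum x, Finset.smul_sum]
      refine Finset.sum_congr rfl fun k _ => ?_
      split_ifs <;> simp [e]
    · rwa [Complex.norm_real, Real.norm_of_nonneg hcpos.le]
    · exact (smul_inv_smul₀ hc0 f).symm

theorem upNorm_le_of_hasSum {p : ℝ} {c : ℕ → ℝ} {d : ℕ → ℝ → B} {f : ℝ → B}
    (hc : Summable c) (hd : ∀ n, IsAtomMultiple p (c n) (d n))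
    (hf : ∀ x, HasSum (fun n => d n x) (f x)) :
    UpNorm p f ≤ ENNReal.ofReal (∑' n, c n) := by
  choose l a ha hl hda using hd
  have hs : Summable fun n => ‖l n‖ := hc.of_nonneg_of_le (fun _ => norm_nonneg _) hl
  have hf' : ∀ x, HasSum (fun n => l n • a n x) (f x) := fun x => by simpa [hda] using hf x
  calc UpNorm p f ≤ ENNReal.ofReal (∑' n, ‖l n‖) := sInf_le ⟨l, a, ha, hs, hf', rfl⟩
    _ ≤ ENNReal.ofReal (∑' n, c n) := ENNReal.ofReal_le_ofReal (hs.tsum_le_tsum hl hc)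

end StepFunctions

section Variation

variable {B : Type*} [NormedAddCommGroup B]

theorem extEReal_coe (v : ℝ → B) (x : ℝ) : extEReal v x = v x := by
  simp [extEReal]

theorem extEReal_top (v : ℝ → B) : extEReal v ⊤ = 0 := by
  simp [extEReal]

theorem sum_sq_le_of_vpNorm {v : ℝ → B} (hv : VpNorm 2 v ≠ ⊤) {K : ℕ}
    {t : Fin (K + 1) → EReal} (ht : StrictMono t) (hb : ∀ i, t i ≠ ⊥) :
    ∑ i : Fin K, ‖extEReal v (t i.succ) - extEReal v (t i.castSucc)‖ ^ 2 ≤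
      (VpNorm 2 v).toReal ^ 2 := by
  have h : ENNReal.ofReal ((∑ i : Fin K,
      ‖extEReal v (t i.succ) - extEReal v (t i.castSucc)‖ ^ (2 : ℝ)) ^ (1 / (2 : ℝ))) ≤
      VpNorm 2 v :=
    le_iSup₂_of_le K t (le_iSup₂_of_le ht hb le_rfl)
  rw [ENNReal.ofReal_le_iff_le_toReal hv, ← Real.sqrt_eq_rpow] at h
  simpa using (Real.sqrt_le_left ENNReal.toReal_nonneg).1 h

theorem norm_le_vpNorm {v : ℝ → B} (hv : VpNorm 2 v ≠ ⊤) (x : ℝ) :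
    ‖v x‖ ≤ (VpNorm 2 v).toReal := by
  have h := sum_sq_le_of_vpNorm hv (K := 1) (t := ![(x : EReal), ⊤])
    (by intro i j h; fin_cases i <;> fin_cases j <;> simp_all)
    (by intro i; fin_cases i <;> simp)
  simp only [Finset.univ_unique, Finset.sum_singleton] at h
  have h' : ‖v x‖ ^ 2 ≤ (VpNorm 2 v).toReal ^ 2 := by
    simpa [extEReal_coe, extEReal_top] using h
  exact le_of_sq_le_sq h' ENNReal.toReal_nonneg

/-- Before time `x` there are `j` consecutive increments of `v` of size greater than `δ`. -/
def HasJumpChain (v : ℝ → B) (δ : ℝ) (j : ℕ) (x : ℝ) : Prop :=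
  ∃ t : Fin (j + 1) → ℝ, StrictMono t ∧ t (Fin.last j) ≤ x ∧
    ∀ i : Fin j, δ < ‖v (t i.succ) - v (t i.castSucc)‖

theorem HasJumpChain.mono {v : ℝ → B} {δ : ℝ} {j : ℕ} {x y : ℝ}
    (h : HasJumpChain v δ j x) (hxy : x ≤ y) : HasJumpChain v δ j y := by
  obtain ⟨t, h1, h2, h3⟩ := h
  exact ⟨t, h1, h2.trans hxy, h3⟩

theorem hasJumpChain_zero (v : ℝ → B) (δ x : ℝ) : HasJumpChain v δ 0 x :=
  ⟨fun _ => x, Subsingleton.strictMono (α := Fin 1) _, le_rfl, fun i => i.elim0⟩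

theorem HasJumpChain.snoc {v : ℝ → B} {δ : ℝ} {j : ℕ} {t : Fin (j + 1) → ℝ}
    (h1 : StrictMono t) (h3 : ∀ i : Fin j, δ < ‖v (t i.succ) - v (t i.castSucc)‖)
    {x : ℝ} (hx : t (Fin.last j) < x) (hδ : δ < ‖v x - v (t (Fin.last j))‖) :
    HasJumpChain v δ (j + 1) x := by
  refine ⟨Fin.snoc (α := fun _ => ℝ) t x, ?_, by simp, fun i => ?_⟩
  · rw [Fin.strictMono_iff_lt_succ]
    intro i
    induction i using Fin.lastCases with
    | last => simpa using hx
    | cast i =>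
      rw [Fin.succ_castSucc, Fin.snoc_castSucc, Fin.snoc_castSucc]
      exact h1 i.castSucc_lt_succ
  · induction i using Fin.lastCases with
    | last => simpa using hδ
    | cast i =>
      rw [Fin.succ_castSucc, Fin.snoc_castSucc, Fin.snoc_castSucc]
      exact h3 i

theorem HasJumpChain.le {v : ℝ → B} (hv : VpNorm 2 v ≠ ⊤) {δ : ℝ} (hδ : 0 < δ) {j : ℕ}
    {x : ℝ} (h : HasJumpChain v δ j x) : (j : ℝ) * δ ^ 2 ≤ (VpNorm 2 v).toReal ^ 2 := by
  obtain ⟨t, h1, -, h3⟩ := h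
  refine le_trans ?_ (sum_sq_le_of_vpNorm hv (t := fun i => (t i : EReal))
    (fun i k hik => EReal.coe_lt_coe_iff.2 (h1 hik)) (fun i => EReal.coe_ne_bot _))
  simp only [extEReal_coe]
  calc (j : ℝ) * δ ^ 2 = ∑ _i : Fin j, δ ^ 2 := by simp
    _ ≤ _ := Finset.sum_le_sum fun i _ => by gcongr; exact (h3 i).le

theorem norm_sub_le_of_hasJumpChain_iff {v : ℝ → B} {δ : ℝ} (hδ : 0 < δ) {M : ℕ}
    (hM : ∀ j x, HasJumpChain v δ j x → j ≤ M) {x y : ℝ} (hxy : x ≤ y)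
    (h : ∀ j, HasJumpChain v δ j y → HasJumpChain v δ j x) : ‖v x - v y‖ ≤ 2 * δ := by
  have hg := Nat.findGreatest_spec (P := fun j => HasJumpChain v δ j x) (Nat.zero_le M)
    (hasJumpChain_zero v δ x)
  set j := Nat.findGreatest (fun j => HasJumpChain v δ j x) M
  have hmax : ¬ HasJumpChain v δ (j + 1) x := fun hj => by
    have := Nat.le_findGreatest (P := fun j => HasJumpChain v δ j x) (hM _ _ hj) hj
    exact absurd this (Nat.lt_succ_self j).not_ge
  obtain ⟨t, h1, h2, h3⟩ := hg
  have key : ∀ z, x ≤ z → z ≤ y → ‖v z - v (t (Fin.last j))‖ ≤ δ := fun z hxz hzy => by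
    rcases (h2.trans hxz).eq_or_lt with he | hlt
    · simp [he, hδ.le]
    · by_contra! hc
      exact hmax (h _ ((HasJumpChain.snoc h1 h3 hlt hc).mono hzy))
  calc ‖v x - v y‖ = ‖(v x - v (t (Fin.last j))) - (v y - v (t (Fin.last j)))‖ := by
        congr 1; abel
    _ ≤ ‖v x - v (t (Fin.last j))‖ + ‖v y - v (t (Fin.last j))‖ := norm_sub_le _ _
    _ ≤ 2 * δ := by linarith [key x le_rfl hxy, key y hxy le_rfl]

theorem exists_finset_norm_sub_le {v : ℝ → B} (hv : VpNorm 2 v ≠ ⊤)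
    (hrc : ∀ t, ContinuousWithinAt v (Set.Ici t) t) {δ : ℝ} (hδ : 0 < δ) {M : ℕ}
    (hM : (VpNorm 2 v).toReal ^ 2 ≤ M * δ ^ 2) :
    ∃ S : Finset ℝ, S.card ≤ M + 1 ∧
      ∀ x y, x ≤ y → (∀ s ∈ S, s ≤ y → s ≤ x) → ‖v x - v y‖ ≤ 2 * δ := by
  have hM' : ∀ j x, HasJumpChain v δ j x → j ≤ M := fun j x h => by
    have := (h.le hv hδ).trans hM
    exact_mod_cast le_of_mul_le_mul_right this (by positivity)
  refine ⟨(Finset.range (M + 1)).image fun j => sInf {t | HasJumpChain v δ j t},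
    Finset.card_image_le.trans (by simp), fun x y hxy hS => ?_⟩
  rcases hxy.eq_or_lt with rfl | hlt
  · simp [hδ.le]
  have hmid : ∀ z ∈ Set.Ioo x y, ‖v z - v y‖ ≤ 2 * δ := fun z hz => by
    refine norm_sub_le_of_hasJumpChain_iff hδ hM' hz.2.le fun j hj => ?_
    by_contra hjz
    have hlb : z ∈ lowerBounds {t | HasJumpChain v δ j t} := fun t ht => by
      by_contra! htz
      exact hjz (HasJumpChain.mono ht htz.le)
    have h1 : z ≤ sInf {t | HasJumpChain v δ j t} := le_csInf ⟨y, hj⟩ hlb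
    have h2 : sInf {t | HasJumpChain v δ j t} ≤ y := csInf_le ⟨z, hlb⟩ hj
    have h3 := hS _ (Finset.mem_image_of_mem _
      (Finset.mem_range.2 (Nat.lt_succ_of_le (hM' j y hj)))) h2
    exact (hz.1.trans_le h1).not_ge h3
  have hlim : Tendsto (fun z => ‖v z - v y‖) (nhdsWithin x (Set.Ioi x))
      (nhds ‖v x - v y‖) :=
    (((hrc x).mono Set.Ioi_subset_Ici_self).tendsto.sub_const _).norm
  exact le_of_tendsto hlim (Filter.mem_of_superset (Ioo_mem_nhdsGT hlt) hmid)

theorem exists_isStepOn_norm_sub_le {v : ℝ → B} (hv : VpNorm 2 v ≠ ⊤)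
    (hrc : ∀ t, ContinuousWithinAt v (Set.Ici t) t) (hlim : Tendsto v atBot (nhds 0))
    {δ : ℝ} (hδ : 0 < δ) {M : ℕ} (hM : (VpNorm 2 v).toReal ^ 2 ≤ M * δ ^ 2) :
    ∃ (S : Finset ℝ) (f : ℝ → B), S.card ≤ M + 1 ∧ IsStepOn S f ∧
      ∀ x, ‖v x - f x‖ ≤ 2 * δ := by
  obtain ⟨S, hcard, hS⟩ := exists_finset_norm_sub_le hv hrc hδ hM
  refine ⟨S, fun x => if h : (S.filter (· ≤ x)).Nonempty then
    v ((S.filter (· ≤ x)).max' h) else 0, hcard, ⟨fun x hx => ?_, fun x y hxy h => ?_⟩,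
    fun x => ?_⟩
  · refine dif_neg ?_
    rintro ⟨s, hs⟩
    rw [Finset.mem_filter] at hs
    exact (hx s hs.1).not_ge hs.2
  · have : S.filter (· ≤ x) = S.filter (· ≤ y) :=
      Finset.filter_congr fun s hs => ⟨fun h' => h'.trans hxy, h s hs⟩
    simp only [this]
  · by_cases h : (S.filter (· ≤ x)).Nonempty
    · simp only [dif_pos h]
      rw [norm_sub_rev]
      exact hS _ _ (Finset.mem_filter.1 (Finset.max'_mem _ h)).2 fun s hs hsx =>
        Finset.le_max' _ _ (Finset.mem_filter.2 ⟨hs, hsx⟩)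
    · simp only [dif_neg h, sub_zero]
      have h1 : Tendsto (fun z => ‖v z - v x‖) atBot (nhds ‖0 - v x‖) :=
        (hlim.sub_const _).norm
      rw [zero_sub, norm_neg] at h1
      refine le_of_tendsto h1 ((eventually_le_atBot x).mono fun z hz =>
        hS _ _ hz fun s hs hsx => ?_)
      exact absurd ⟨s, Finset.mem_filter.2 ⟨hs, hsx⟩⟩ h

end Variation

section Decomposition

variable {B : Type*} [NormedAddCommGroup B] [NormedSpace ℂ B]

theorem IsAtomMultiple.mono {p c c' : ℝ} {f : ℝ → B} (h : IsAtomMultiple p c f)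
    (hc : c ≤ c') : IsAtomMultiple p c' f := by
  obtain ⟨l, a, ha, hl, hf⟩ := h
  exact ⟨l, a, ha, hl.trans hc, hf⟩

theorem dyadic_step_bound {V p : ℝ} (hV : 0 ≤ V) (hp : 2 ≤ p) (n : ℕ) :
    3 * V / 2 ^ n * (7 * 4 ^ n) ^ (1 / p) ≤ 21 * V * ((2 : ℝ) ^ (-(1 - 2 / p))) ^ n := by
  have h7 : (7 : ℝ) ^ (1 / p) ≤ 7 := by
    conv_rhs => rw [← Real.rpow_one 7]
    refine Real.rpow_le_rpow_of_exponent_le (by norm_num) ?_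
    rw [div_le_one (by linarith)]
    linarith
  have h4 : ((4 : ℝ) ^ n) ^ (1 / p) / 2 ^ n = ((2 : ℝ) ^ (-(1 - 2 / p))) ^ n := by
    rw [show (4 : ℝ) = 2 ^ 2 by norm_num, ← pow_mul, ← Real.rpow_natCast 2 (2 * n),
      ← Real.rpow_natCast 2 n, ← Real.rpow_mul (by norm_num), ← Real.rpow_sub (by norm_num),
      ← Real.rpow_natCast _ n, ← Real.rpow_mul (by norm_num)]
    congr 1
    push_cast
    ring
  rw [Real.mul_rpow (by norm_num) (by positivity)]
  calc 3 * V / 2 ^ n * (7 ^ (1 / p) * (4 ^ n) ^ (1 / p))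
      = 3 * V * 7 ^ (1 / p) * (((4 : ℝ) ^ n) ^ (1 / p) / 2 ^ n) := by ring
    _ ≤ 3 * V * 7 * (((4 : ℝ) ^ n) ^ (1 / p) / 2 ^ n) := by gcongr
    _ = _ := by rw [h4]; ring

theorem exists_dyadic_decomposition {v : ℝ → B} (hv : VpNorm 2 v ≠ ⊤)
    (hrc : ∀ t, ContinuousWithinAt v (Set.Ici t) t) (hlim : Tendsto v atBot (nhds 0))
    (hv0 : v ≠ 0) :
    ∃ d : ℕ → ℝ → B, (∀ x, HasSum (fun n => d n x) (v x)) ∧ ∀ n p, 2 ≤ p →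
      IsAtomMultiple p (21 * (VpNorm 2 v).toReal * ((2 : ℝ) ^ (-(1 - 2 / p))) ^ n) (d n) := by
  obtain ⟨x₀, hx₀⟩ := Function.ne_iff.1 hv0
  have : Nontrivial B := ⟨v x₀, 0, hx₀⟩
  set V := (VpNorm 2 v).toReal with hVdef
  have hV : 0 < V := (norm_pos_iff.2 hx₀).trans_le (norm_le_vpNorm hv x₀)
  have hstep : ∀ n : ℕ, ∃ (S : Finset ℝ) (f : ℝ → B), S.card ≤ 4 ^ n + 1 ∧ IsStepOn S f ∧
      (∀ x, ‖v x - f x‖ ≤ 2 * (V / 2 ^ n)) ∧ (n = 0 → f = 0) := by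
    rintro (_ | n)
    · refine ⟨∅, 0, by simp, ⟨by simp, by simp⟩, fun x => ?_, fun _ => rfl⟩
      have := norm_le_vpNorm hv x
      simp only [Pi.zero_apply, sub_zero, pow_zero, div_one]
      linarith
    · obtain ⟨S, f, h1, h2, h3⟩ := exists_isStepOn_norm_sub_le hv hrc hlim
        (δ := V / 2 ^ (n + 1)) (by positivity) (M := 4 ^ (n + 1)) (by
          rw [← hVdef, div_pow, ← pow_mul, mul_comm (n + 1) 2, pow_mul]
          push_cast
          norm_num
          rw [mul_div_cancel₀ _ (by positivity)])
      exact ⟨S, f, h1, h2, h3, by simp⟩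
  choose S f hcard hf hvf hf0 using hstep
  have hd : ∀ n x, ‖f (n + 1) x - f n x‖ ≤ 3 * V / 2 ^ n := fun n x => by
    calc ‖f (n + 1) x - f n x‖ = ‖(v x - f n x) - (v x - f (n + 1) x)‖ := by
          congr 1; abel
      _ ≤ 2 * (V / 2 ^ n) + 2 * (V / 2 ^ (n + 1)) :=
          (norm_sub_le _ _).trans (add_le_add (hvf n x) (hvf (n + 1) x))
      _ = 3 * V / 2 ^ n := by rw [pow_succ]; field_simp; ring
  refine ⟨fun n => f (n + 1) - f n, fun x => ?_, fun n p hp => ?_⟩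
  · have hgeom : ∀ c : ℝ, (fun n : ℕ => c / 2 ^ n) = fun n => c * (1 / 2) ^ n := fun c => by
      funext n
      rw [one_div, inv_pow, div_eq_mul_inv]
    have hs : Summable fun n => ‖f (n + 1) x - f n x‖ := by
      refine Summable.of_nonneg_of_le (fun _ => norm_nonneg _) (fun n => hd n x) ?_
      rw [hgeom]
      exact summable_geometric_two.mul_left _
    refine (hasSum_iff_tendsto_nat_of_summable_norm hs).2 ?_
    simp_rw [Finset.sum_range_sub (fun n => f n x), hf0 0 rfl, Pi.zero_apply, sub_zero]
    rw [tendsto_iff_norm_sub_tendsto_zero]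
    refine squeeze_zero (g := fun n : ℕ => 2 * (V / 2 ^ n)) (fun _ => norm_nonneg _)
      (fun n => by rw [norm_sub_rev]; exact hvf n x) ?_
    rw [← mul_zero (2 : ℝ)]
    refine Tendsto.const_mul _ ?_
    rw [hgeom, ← mul_zero V]
    exact (tendsto_pow_atTop_nhds_zero_of_lt_one (by norm_num) (by norm_num)).const_mul _
  · refine (((hf (n + 1)).sub (hf n)).isAtomMultiple (by linarith) (hd n) (by positivity)
      (K := 7 * 4 ^ n) ?_).mono (dyadic_step_bound hV.le hp n)
    have h1 : (S (n + 1) ∪ S n).card ≤ 7 * 4 ^ n := by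
      have h2 := Finset.card_union_le (S (n + 1)) (S n)
      have h3 := hcard (n + 1)
      have h4 := hcard n
      have h5 := Nat.one_le_pow n 4 (by norm_num)
      rw [pow_succ] at h3
      omega
    exact_mod_cast h1

/-- Splitting of a `V²` function into a part in `U²` and a small remainder in `U^q`. -/
theorem exists_add_eq_upNorm_le {v : ℝ → B} (hv : VpNorm 2 v ≠ ⊤)
    (hrc : ∀ t, ContinuousWithinAt v (Set.Ici t) t) (hlim : Tendsto v atBot (nhds 0))
    (hv0 : v ≠ 0) {q ρ : ℝ} (hq : 2 ≤ q) (hρ : (2 : ℝ) ^ (-(1 - 2 / q)) ≤ ρ) (hρ1 : ρ < 1)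
    (N : ℕ) :
    ∃ a w : ℝ → B, a + w = v ∧
      UpNorm 2 a ≤ ENNReal.ofReal (21 * (VpNorm 2 v).toReal * N) ∧
      UpNorm q a ≤ ENNReal.ofReal (21 / (1 - ρ) * (VpNorm 2 v).toReal) ∧
      UpNorm q w ≤ ENNReal.ofReal (21 / (1 - ρ) * (VpNorm 2 v).toReal * ρ ^ N) := by
  obtain ⟨d, hd, hatom⟩ := exists_dyadic_decomposition hv hrc hlim hv0
  obtain ⟨x₀, hx₀⟩ := Function.ne_iff.1 hv0
  have : Nontrivial B := ⟨v x₀, 0, hx₀⟩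
  set V := (VpNorm 2 v).toReal
  have hV : 0 ≤ V := ENNReal.toReal_nonneg
  have hρ0 : 0 < ρ := lt_of_lt_of_le (by positivity) hρ
  have h2 : ∀ n, IsAtomMultiple 2 (21 * V) (d n) := fun n => by
    simpa using hatom n 2 le_rfl
  have hqd : ∀ n, IsAtomMultiple q (21 * V * ρ ^ n) (d n) := fun n =>
    (hatom n q hq).mono (by gcongr)
  have ha : ∀ x, HasSum (fun n => (if n < N then d n else 0) x)
      ((∑ n ∈ Finset.range N, d n) x) := fun x => by
    have h := hasSum_sum_of_ne_finset_zero (L := .unconditional ℕ)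
      (f := fun n => (if n < N then d n else 0) x) (s := Finset.range N)
      (fun n hn => by rw [if_neg (by simpa using hn), Pi.zero_apply])
    convert h using 1
    rw [Finset.sum_apply]
    exact Finset.sum_congr rfl fun n hn => by rw [if_pos (Finset.mem_range.1 hn)]
  have hsum : HasSum (fun n => 21 * V * ρ ^ n) (21 / (1 - ρ) * V) := by
    rw [show 21 / (1 - ρ) * V = 21 * V * (1 - ρ)⁻¹ by ring]
    exact (hasSum_geometric_of_lt_one hρ0.le hρ1).mul_left (21 * V)
  refine ⟨∑ n ∈ Finset.range N, d n, v - ∑ n ∈ Finset.range N, d n, by simp, ?_, ?_, ?_⟩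
  · have hc := hasSum_sum_of_ne_finset_zero (L := .unconditional ℕ)
      (f := fun n => if n < N then 21 * V else 0) (s := Finset.range N)
      (fun n hn => if_neg (by simpa using hn))
    refine (upNorm_le_of_hasSum hc.summable (fun n => ?_) ha).trans_eq ?_
    · split_ifs
      · exact h2 n
      · exact isAtomMultiple_zero le_rfl
    · rw [hc.tsum_eq, Finset.sum_congr rfl fun n hn => if_pos (Finset.mem_range.1 hn)]
      simp [mul_comm]
  · refine (upNorm_le_of_hasSum hsum.summable (fun n => ?_) ha).trans_eq (by rw [hsum.tsum_eq])
    split_ifs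
    · exact hqd n
    · exact isAtomMultiple_zero (by positivity)
  · have hs := hsum.mul_right (ρ ^ N)
    refine (upNorm_le_of_hasSum hs.summable (d := fun n => d (n + N)) (fun n => ?_)
      fun x => ?_).trans_eq (by rw [hs.tsum_eq])
    · convert hqd (n + N) using 1
      rw [pow_add, mul_assoc]
    · simpa using (hasSum_nat_add_iff' N).2 (hd x)

end Decomposition

section Interpolation

variable {m : ℕ} {B E : Type*} [NormedAddCommGroup B] [NormedSpace ℂ B]
  [NormedAddCommGroup E]

theorem norm_le_of_upNorm_le {T : (Fin m → ℝ → B) → E} {C : ℝ} (hC : 0 ≤ C)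
    {p : Fin m → ℝ} {u : Fin m → ℝ → B} {c : Fin m → ℝ} (hc : ∀ i, 0 ≤ c i)
    (hT : ENNReal.ofReal ‖T u‖ ≤ ENNReal.ofReal C * ∏ i, UpNorm (p i) (u i))
    (hu : ∀ i, UpNorm (p i) (u i) ≤ ENNReal.ofReal (c i)) : ‖T u‖ ≤ C * ∏ i, c i := by
  have h := hT.trans (mul_le_mul_right (Finset.prod_le_prod' fun i _ => hu i) _)
  rw [← ENNReal.ofReal_prod_of_nonneg fun i _ => hc i, ← ENNReal.ofReal_mul hC] at h
  exact (ENNReal.ofReal_le_ofReal_iff (mul_nonneg hC (Finset.prod_nonneg fun i _ => hc i))).1 h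

variable [NormedSpace ℂ E]

/-- A multilinear map is bounded at a sum through its values at all mixed tuples. -/
theorem norm_map_add_le (T : MultilinearMap ℂ (fun _ : Fin m => ℝ → B) E)
    (a w : Fin m → ℝ → B) {R : ℝ}
    (h : ∀ s : Finset (Fin m), ‖T (s.piecewise a w)‖ ≤ R) : ‖T (a + w)‖ ≤ 2 ^ m * R := by
  rw [T.map_add_univ]
  refine (norm_sum_le_of_le _ fun s _ => h s).trans_eq ?_
  simp

theorem exists_nat_pow_mul_le {C C₂ ρ : ℝ} (hC₂ : 0 < C₂) (hC : C₂ ≤ C) (hρ0 : 0 < ρ)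
    (hρ1 : ρ < 1) : ∃ N : ℕ, C * ρ ^ N ≤ C₂ ∧
      (N : ℝ) ≤ (1 / -Real.log ρ + 1) * (Real.log (C / C₂) + 1) := by
  have hl : 0 < -Real.log ρ := neg_pos.2 (Real.log_neg hρ0 hρ1)
  have hL : 0 ≤ Real.log (C / C₂) := Real.log_nonneg ((one_le_div hC₂).2 hC)
  have hCpos : 0 < C := hC₂.trans_le hC
  refine ⟨⌈Real.log (C / C₂) / -Real.log ρ⌉₊, ?_, ?_⟩
  · have h := Nat.le_ceil (Real.log (C / C₂) / -Real.log ρ)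
    set N := ⌈Real.log (C / C₂) / -Real.log ρ⌉₊
    rw [div_le_iff₀ hl, Real.log_div hCpos.ne' hC₂.ne'] at h
    rw [← Real.log_le_log_iff (by positivity) hC₂, Real.log_mul hCpos.ne' (by positivity),
      Real.log_pow]
    linarith
  · refine (Nat.ceil_lt_add_one (by positivity)).le.trans ?_
    have h1 : 0 ≤ 1 / -Real.log ρ := by positivity
    rw [div_eq_mul_one_div]
    nlinarith

theorem exists_common_decay_rate (q : Fin m → ℝ) (hq : ∀ i, 2 < q i) :
    ∃ ρ : ℝ, 0 < ρ ∧ ρ < 1 ∧ ∀ i, (2 : ℝ) ^ (-(1 - 2 / q i)) ≤ ρ := by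
  have h : ∀ i, (2 : ℝ) ^ (-(1 - 2 / q i)) < 1 := fun i => by
    refine Real.rpow_lt_one_of_one_lt_of_neg (by norm_num) ?_
    have : 2 / q i < 1 := (div_lt_one (by linarith [hq i])).2 (hq i)
    linarith
  let F : Finset ℝ := insert (1 / 2) (Finset.univ.image fun i => (2 : ℝ) ^ (-(1 - 2 / q i)))
  have hF : F.Nonempty := Finset.insert_nonempty _ _
  refine ⟨F.max' hF, ?_, ?_, fun i => ?_⟩
  · exact lt_of_lt_of_le (by norm_num) (F.le_max' (1 / 2) (Finset.mem_insert_self _ _))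
  · rw [Finset.max'_lt_iff]
    intro y hy
    rcases Finset.mem_insert.1 hy with rfl | hy
    · norm_num
    · obtain ⟨i, -, rfl⟩ := Finset.mem_image.1 hy
      exact h i
  · exact F.le_max' _ (Finset.mem_insert_of_mem (Finset.mem_image_of_mem _ (Finset.mem_univ i)))

theorem norm_multilinear_le_of_decay_rate (T : MultilinearMap ℂ (fun _ : Fin m => ℝ → B) E)
    {q : Fin m → ℝ} (hq : ∀ i, 2 < q i) {ρ : ℝ} (hρ0 : 0 < ρ) (hρ1 : ρ < 1)
    (hρ : ∀ i, (2 : ℝ) ^ (-(1 - 2 / q i)) ≤ ρ) {C C₂ : ℝ} (hC₂ : 0 < C₂) (hC : C₂ ≤ C)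
    (hT : ∀ u, ENNReal.ofReal ‖T u‖ ≤ ENNReal.ofReal C * ∏ i, UpNorm (q i) (u i))
    (hT₂ : ∀ u, ENNReal.ofReal ‖T u‖ ≤ ENNReal.ofReal C₂ * ∏ i, UpNorm 2 (u i))
    {u : Fin m → ℝ → B} (hrc : ∀ i t, ContinuousWithinAt (u i) (Set.Ici t) t)
    (hlim : ∀ i, Tendsto (u i) atBot (nhds 0)) (hu : ∀ i, VpNorm 2 (u i) ≠ ⊤)
    (hu0 : ∀ i, u i ≠ 0) :
    ‖T u‖ ≤ (2 * (21 / (1 - ρ) * (1 / -Real.log ρ + 1))) ^ m * C₂ *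
      (Real.log (C / C₂) + 1) ^ m * ∏ i, (VpNorm 2 (u i)).toReal := by
  obtain ⟨N, hN, hNle⟩ := exists_nat_pow_mul_le hC₂ hC hρ0 hρ1
  choose a w haw ha2 haq hwq using fun i =>
    exists_add_eq_upNorm_le (hu i) (hrc i) (hlim i) (hu0 i) (hq i).le (hρ i) hρ1 N
  have hCpos : 0 < C := hC₂.trans_le hC
  have hL : 0 ≤ Real.log (C / C₂) := Real.log_nonneg ((one_le_div hC₂).2 hC)
  have hl : 0 < -Real.log ρ := neg_pos.2 (Real.log_neg hρ0 hρ1)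
  set V : Fin m → ℝ := fun i => (VpNorm 2 (u i)).toReal
  have hV : ∀ i, 0 ≤ V i := fun i => ENNReal.toReal_nonneg
  set A : ℝ := 21 / (1 - ρ) with hA
  set β : ℝ := 1 / -Real.log ρ + 1 with hβ
  set L : ℝ := Real.log (C / C₂) + 1 with hLdef
  have hA21 : 21 ≤ A := by
    rw [hA, le_div_iff₀ (by linarith)]
    linarith
  have hβ1 : 1 ≤ β := by
    have : 0 ≤ 1 / -Real.log ρ := by positivity
    linarith
  have hL1 : 1 ≤ L := by linarith
  have hA0 : 0 ≤ A := by linarith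
  have hVprod : 0 ≤ ∏ i, V i := Finset.prod_nonneg fun i _ => hV i
  have hpiece : ∀ s : Finset (Fin m), ‖T (s.piecewise a w)‖ ≤
      C₂ * ((A * (β * L)) ^ m * ∏ i, V i) := fun s => by
    by_cases hs : s = Finset.univ
    · rw [hs, Finset.piecewise_univ]
      refine (norm_le_of_upNorm_le (T := T) hC₂.le (fun i => by have := hV i; positivity)
        (hT₂ a) ha2).trans ?_
      gcongr
      calc ∏ i, 21 * V i * N ≤ ∏ i, (A * (β * L)) * V i := by
            refine Finset.prod_le_prod (fun i _ => by have := hV i; positivity) fun i _ => ?_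
            have := hV i
            calc 21 * V i * N ≤ A * V i * (β * L) := by gcongr
              _ = _ := by ring
        _ = _ := by simp [Finset.prod_mul_distrib]
    · obtain ⟨i₀, hi₀⟩ : ∃ i, i ∉ s := by
        by_contra! h
        exact hs (Finset.eq_univ_iff_forall.2 h)
      have hle : ∀ i, UpNorm (q i) (s.piecewise a w i) ≤
          ENNReal.ofReal (A * V i * if i = i₀ then ρ ^ N else 1) := fun i => by
        by_cases hi : i = i₀
        · rw [if_pos hi, Finset.piecewise_eq_of_notMem _ _ _ (hi ▸ hi₀)]
          exact hwq i
        · rw [if_neg hi, mul_one]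
          by_cases his : i ∈ s
          · rw [Finset.piecewise_eq_of_mem _ _ _ his]
            exact haq i
          · rw [Finset.piecewise_eq_of_notMem _ _ _ his]
            refine (hwq i).trans (ENNReal.ofReal_le_ofReal ?_)
            exact mul_le_of_le_one_right (mul_nonneg hA0 (hV i)) (pow_le_one₀ hρ0.le hρ1.le)
      refine (norm_le_of_upNorm_le (T := T) hCpos.le (fun i => ?_) (hT _) hle).trans ?_
      · have := hV i
        split_ifs <;> positivity
      · rw [Finset.prod_mul_distrib, Finset.prod_mul_distrib, Finset.prod_ite_eq']
        simp only [Finset.prod_const, Finset.card_univ, Fintype.card_fin, Finset.mem_univ,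
          if_true]
        calc C * (A ^ m * (∏ i, V i) * ρ ^ N) = (C * ρ ^ N) * (A ^ m * ∏ i, V i) := by ring
          _ ≤ C₂ * ((A * (β * L)) ^ m * ∏ i, V i) := by
            gcongr
            exact le_mul_of_one_le_right hA0 (one_le_mul_of_one_le_of_one_le hβ1 hL1)
  have hsplit : a + w = u := funext haw
  calc ‖T u‖ = ‖T (a + w)‖ := by rw [hsplit]
    _ ≤ 2 ^ m * (C₂ * ((A * (β * L)) ^ m * ∏ i, V i)) := norm_map_add_le T a w hpiece
    _ = _ := by simp only [mul_pow]; ring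

end Interpolation

/-- **Interpolation with logarithmic loss between atomic spaces** (Proposition B.10).
Let `m ∈ {1,2,3}` and `q₁, …, q_m ∈ (2, ∞)`.  There is a constant `κ > 0`, depending only
on `m` and `q₁, …, q_m`, with the following property.  Let `B, E` be Banach spaces and let
`T` be an `m`-linear map on `m`-tuples of functions `ℝ → B` with values in `E` such that
`‖T(u₁, …, u_m)‖_E ≤ C ∏ᵢ ‖uᵢ‖_{U^{qᵢ}}` and `‖T(u₁, …, u_m)‖_E ≤ C₂ ∏ᵢ ‖uᵢ‖_{U²}`
for constants `0 < C₂ ≤ C` (the bounds being understood for members of the respective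
atomic spaces; with `ℝ≥0∞`-valued norms they are vacuous otherwise).  Then for all
right-continuous `uᵢ : ℝ → B` with `uᵢ(t) → 0` as `t → -∞` and finite `V²`-norm,
`‖T(u₁, …, u_m)‖_E ≤ κ C₂ (log(C/C₂) + 1)^m ∏ᵢ ‖uᵢ‖_{V²}`. -/
theorem interpolation_log_loss (m : ℕ) (hm1 : 1 ≤ m) (hm3 : m ≤ 3)
    (q : Fin m → ℝ) (hq : ∀ i, 2 < q i) :
    ∃ κ > (0:ℝ),
      ∀ (B : Type*) [NormedAddCommGroup B] [NormedSpace ℂ B]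
        (E : Type*) [NormedAddCommGroup E] [NormedSpace ℂ E]
        (T : (Fin m → ℝ → B) → E) (C C₂ : ℝ), 0 < C₂ → C₂ ≤ C →
        (∀ (u : Fin m → ℝ → B) (i : Fin m) (f g : ℝ → B),
          T (Function.update u i (f + g)) =
            T (Function.update u i f) + T (Function.update u i g)) →
        (∀ (u : Fin m → ℝ → B) (i : Fin m) (a : ℂ) (f : ℝ → B),
          T (Function.update u i (a • f)) = a • T (Function.update u i f)) →
        (∀ u : Fin m → ℝ → B,
          ENNReal.ofReal ‖T u‖ ≤ ENNReal.ofReal C * ∏ i, UpNorm (q i) (u i)) →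
        (∀ u : Fin m → ℝ → B,
          ENNReal.ofReal ‖T u‖ ≤ ENNReal.ofReal C₂ * ∏ i, UpNorm 2 (u i)) →
        ∀ u : Fin m → ℝ → B,
          (∀ i, ∀ t : ℝ, ContinuousWithinAt (u i) (Set.Ici t) t) →
          (∀ i, Filter.Tendsto (u i) Filter.atBot (nhds 0)) →
          (∀ i, VpNorm 2 (u i) ≠ ⊤) →
          ENNReal.ofReal ‖T u‖ ≤
            ENNReal.ofReal (κ * C₂ * (Real.log (C / C₂) + 1) ^ m) *
              ∏ i, VpNorm 2 (u i) := by
  obtain ⟨ρ, hρ0, hρ1, hρ⟩ := exists_common_decay_rate q hq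
  have hl : 0 < -Real.log ρ := neg_pos.2 (Real.log_neg hρ0 hρ1)
  have hρ' : 0 < 1 - ρ := by linarith
  refine ⟨(2 * (21 / (1 - ρ) * (1 / -Real.log ρ + 1))) ^ m, by positivity, ?_⟩
  intro B _ _ E _ _ T C C₂ hC₂ hC hadd hsmul hT hT₂ u hrc hlim hu
  let T' : MultilinearMap ℂ (fun _ : Fin m => ℝ → B) E :=
    { toFun := T
      map_update_add' := fun u i f g => by convert hadd u i f g
      map_update_smul' := fun u i c f => by convert hsmul u i c f }
  have hL : 0 ≤ Real.log (C / C₂) := Real.log_nonneg ((one_le_div hC₂).2 hC)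
  by_cases h0 : ∃ i, u i = 0
  · obtain ⟨i, hi⟩ := h0
    have hTu : T u = 0 := T'.map_coord_zero i hi
    simp [hTu]
  · push Not at h0
    have h := norm_multilinear_le_of_decay_rate T' hq hρ0 hρ1 hρ hC₂ hC hT hT₂ hrc hlim hu h0
    refine (ENNReal.ofReal_le_ofReal h).trans_eq ?_
    rw [ENNReal.ofReal_mul (by positivity),
      ENNReal.ofReal_prod_of_nonneg fun i _ => ENNReal.toReal_nonneg]
    simp only [ENNReal.ofReal_toReal (hu _)]
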